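/- arXiv:2402.15463 — 2 statements merged into one kernel-verified Lean document; each statement's English description precedes it below -/
import Mathlib

section
/- Let a_n be the number of 231-avoiding permutations of [n] of order dividing 3 (i.e., composed only of 3-cycles and fixed points). Then the generating function identity (1 - z - 3z³ - z⁵)·Σ_{n≥0} a_n zⁿ = 1 - 2z³ holds; equivalently, for n ≥ 6, a_n = a_{n-1} + 3a_{n-3} + a_{n-5}, with initial values a_0=1, a_1=1, a_2=1, a_3=2, a_4=5, a_5=9. -/
def Avoids231 {n : ℕ} (π : Equiv.Perm (Fin n)) : Prop :=
  ¬ ∃ i j k : Fin n, i < j ∧ j < k ∧ π k < π i ∧ π i < π j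

/-- The number of 231-avoiding permutations of `[n]` of order dividing 3. -/
noncomputable def a (n : ℕ) : ℕ := Nat.card {π : Equiv.Perm (Fin n) // Avoids231 π ∧ π ^ 3 = 1}


/-- Model of the permutations as self-maps of `ℕ` fixing everything from `n` on. -/
def SS (n : ℕ) : Set (ℕ → ℕ) :=
  {f | (∀ i, f (f (f i)) = i) ∧ (∀ i, n ≤ i → f i = i) ∧
    ∀ i j k, i < j → j < k → f k < f i → f i < f j → False}

/-- Those of size `m + 1` that start with their maximum. -/
def UU (m : ℕ) : Set (ℕ → ℕ) := {f | f ∈ SS (m + 1) ∧ f 0 = m}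

theorem ss_lt {n : ℕ} {f : ℕ → ℕ} (hf : f ∈ SS n) {i : ℕ} (hi : i < n) : f i < n := by
  obtain ⟨h1, h2, _⟩ := hf
  by_contra h
  have a1 := h2 (f i) (by omega)
  have a2 := h1 i
  rw [a1, a1] at a2
  omega

theorem ss_inj {n : ℕ} {f : ℕ → ℕ} (hf : f ∈ SS n) {i j : ℕ} (h : f i = f j) : i = j := by
  rw [← hf.1 i, ← hf.1 j, h]

noncomputable def ssEquiv (n : ℕ) :
    {π : Equiv.Perm (Fin n) // Avoids231 π ∧ π ^ 3 = 1} ≃ SS n where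
  toFun π := ⟨fun i => if h : i < n then (π.1 ⟨i, h⟩ : ℕ) else i, by
    obtain ⟨π, hav, h3⟩ := π
    have h3' : ∀ x, π (π (π x)) = x := fun x => by
      have := congrArg (fun σ : Equiv.Perm (Fin n) => σ x) h3
      simpa [pow_succ] using this
    refine ⟨?_, ?_, ?_⟩
    · intro i
      by_cases h : i < n
      · simp [h, h3']
      · simp [h]
    · intro i hi
      simp [not_lt.mpr hi]
    · intro i j k hij hjk hki hij'
      by_cases hk : k < n
      · have hj : j < n := by omega
        have hi : i < n := by omega
        simp only [hi, hj, hk, dite_true] at hki hij'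
        exact hav ⟨⟨i, hi⟩, ⟨j, hj⟩, ⟨k, hk⟩, hij, hjk, hki, hij'⟩
      · simp only [hk, dite_false] at hki
        split_ifs at hki with hi
        · have := (π ⟨i, hi⟩).2
          omega
        · omega⟩
  invFun f := ⟨⟨fun i => ⟨f.1 i, ss_lt f.2 i.2⟩, fun i => ⟨f.1 (f.1 i), ss_lt f.2 (ss_lt f.2 i.2)⟩,
      fun i => Fin.ext (f.2.1 i), fun i => Fin.ext (f.2.1 i)⟩, by
    obtain ⟨f, hf⟩ := f
    constructor
    · rintro ⟨i, j, k, hij, hjk, h1, h2⟩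
      exact hf.2.2 i j k hij hjk h1 h2
    · ext i
      simpa [pow_succ] using hf.1 i⟩
  left_inv π := by
    ext i
    simp
  right_inv f := by
    ext i
    by_cases h : i < n
    · simp [h]
    · simp [h, f.2.2.1 i (by omega)]

theorem a_eq (n : ℕ) : a n = (SS n).ncard := by
  unfold a
  rw [Nat.card_congr (ssEquiv n)]
  rfl

theorem ss_finite (n : ℕ) : (SS n).Finite := by
  have : Finite (SS n) := Finite.of_equiv _ (ssEquiv n)
  exact Set.toFinite _

theorem uu_finite (n : ℕ) : (UU n).Finite := (ss_finite (n+1)).subset fun _ h => h.1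

theorem small : a 0 = 1 ∧ a 1 = 1 ∧ a 2 = 1 ∧ a 3 = 2 ∧ a 4 = 5 ∧ a 5 = 9 := by
  have key : ∀ n, a n = (Finset.univ.filter fun π : Equiv.Perm (Fin n) =>
      (∀ i, π (π (π i)) = i) ∧
        ∀ i j k : Fin n, i < j → j < k → π k < π i → π i < π j → False).card := by
    intro n
    unfold a
    classical
    rw [Nat.card_eq_fintype_card, Fintype.card_subtype]
    congr 1
    ext π
    simp only [Finset.mem_filter, Finset.mem_univ, true_and]
    rw [and_comm]
    apply and_congr
    rotate_left
    · unfold Avoids231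
      push Not
      constructor
      · intro h i j k h1 h2 h3 h4
        exact absurd h4 (not_lt.mpr (h i j k h1 h2 h3))
      · intro h i j k h1 h2 h3
        exact not_lt.mp (h i j k h1 h2 h3)
    · rw [Equiv.ext_iff]
      simp [pow_succ]
  simp only [key]
  refine ⟨?_, ?_, ?_, ?_, ?_, ?_⟩ <;> decide +kernel

theorem ss_block {n : ℕ} {f : ℕ → ℕ} (hf : f ∈ SS n) {i : ℕ} (hi : i ≤ f 0) : f i ≤ f 0 := by
  by_contra h
  push Not at h
  have hk : ∀ k, f k ≤ f 0 → k < i := by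
    intro k hk
    by_contra hki
    have h1 : k ≠ i := by rintro rfl; omega
    have h2 : i ≠ 0 := by rintro rfl; omega
    have h3 : f k ≠ f 0 := fun h => by have := ss_inj hf h; omega
    exact hf.2.2 0 i k (by omega) (by omega) (by omega) h
  have := Finset.card_le_card_of_injOn (s := Finset.range (f 0 + 1)) (t := Finset.range i)
    (fun x => f (f x)) (by
      intro x hx
      simp only [Finset.coe_range, Set.mem_Iio] at hx ⊢
      apply hk
      rw [hf.1]
      omega) (fun x _ y _ h => ss_inj hf (ss_inj hf h))
  simp at this
  omega

theorem ss_block' {n : ℕ} {f : ℕ → ℕ} (hf : f ∈ SS n) {i : ℕ} (hi : f 0 < i) : f 0 < f i := by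
  by_contra h
  have := ss_block hf (ss_block hf (not_lt.mp h))
  rw [hf.1] at this
  omega

/-- Direct sum. -/
def glue (m : ℕ) (p : (ℕ → ℕ) × (ℕ → ℕ)) : ℕ → ℕ :=
  fun i => if i ≤ m then p.1 i else p.2 (i - (m + 1)) + (m + 1)

theorem fiber (n m : ℕ) (hm : m ≤ n) :
    {f | f ∈ SS (n + 1) ∧ f 0 = m} = glue m '' (UU m ×ˢ SS (n - m)) := by
  ext h
  constructor
  · rintro ⟨hh, rfl⟩
    refine ⟨(fun i => if i ≤ h 0 then h i else i, fun i => h (i + (h 0 + 1)) - (h 0 + 1)),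
      ⟨⟨⟨?_, ?_, ?_⟩, ?_⟩, ?_, ?_, ?_⟩, ?_⟩
    · intro i
      by_cases hi : i ≤ h 0
      · have h1 := ss_block hh hi
        have h2 := ss_block hh h1
        simp [hi, h1, h2, hh.1]
      · simp [hi]
    · intro i hi
      simp [show ¬ i ≤ h 0 by omega]
    · intro i j k hij hjk h1 h2
      by_cases hk : k ≤ h 0
      · simp only [hk, show i ≤ h 0 by omega, show j ≤ h 0 by omega, if_true] at h1 h2
        exact hh.2.2 i j k hij hjk h1 h2
      · simp only [hk, if_false] at h1
        split_ifs at h1 with hi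
        · have := ss_block hh hi; omega
        · omega
    · simp
    · intro i
      have h1 := ss_block' hh (i := i + (h 0 + 1)) (by omega)
      have h2 := ss_block' hh h1
      simp only
      rw [Nat.sub_add_cancel h1, Nat.sub_add_cancel h2, hh.1]
      omega
    · intro i hi
      simp only
      rw [hh.2.1 _ (by omega)]
      omega
    · intro i j k hij hjk h1 h2
      simp only at h1 h2
      exact hh.2.2 (i + (h 0 + 1)) (j + (h 0 + 1)) (k + (h 0 + 1)) (by omega) (by omega)
        (by omega) (by omega)
    · funext i
      by_cases hi : i ≤ h 0
      · simp [glue, hi]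
      · have := ss_block' hh (i := i) (by omega)
        simp only [glue, hi, if_false]
        rw [Nat.sub_add_cancel (show h 0 + 1 ≤ i by omega), Nat.sub_add_cancel this]
  · rintro ⟨⟨f, g⟩, ⟨⟨hf, hf0⟩, hg⟩, rfl⟩
    simp only at hf hf0 hg
    have e1 : ∀ i, i ≤ m → glue m (f, g) i = f i := fun i hi => by simp [glue, hi]
    have e2 : ∀ i, m < i → glue m (f, g) i = g (i - (m + 1)) + (m + 1) := fun i hi => by
      simp [glue, not_le.mpr hi]
    have l1 : ∀ i, i ≤ m → f i ≤ m := fun i hi => by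
      have := ss_lt hf (i := i) (by omega); omega
    refine ⟨⟨?_, ?_, ?_⟩, ?_⟩
    · intro i
      by_cases hi : i ≤ m
      · rw [e1 i hi, e1 _ (l1 _ hi), e1 _ (l1 _ (l1 _ hi)), hf.1]
      · rw [e2 i (by omega), e2 (g _ + _) (by omega), Nat.add_sub_cancel, e2 (g _ + _) (by omega),
          Nat.add_sub_cancel, hg.1]
        omega
    · intro i hi
      rw [e2 i (by omega), hg.2.1 _ (by omega)]
      omega
    · intro i j k hij hjk h1 h2
      by_cases hi : i ≤ m
      · have := l1 i hi
        by_cases hk : k ≤ m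
        · rw [e1 i hi, e1 k hk] at h1
          rw [e1 i hi, e1 j (by omega)] at h2
          exact hf.2.2 i j k hij hjk h1 h2
        · rw [e1 i hi, e2 k (by omega)] at h1
          omega
      · rw [e2 i (by omega), e2 k (by omega)] at h1
        rw [e2 i (by omega), e2 j (by omega)] at h2
        exact hg.2.2 (i - (m+1)) (j - (m+1)) (k - (m+1)) (by omega) (by omega) (by omega) (by omega)
    · rw [e1 0 (by omega), hf0]

theorem glue_inj (n m : ℕ) : Set.InjOn (glue m) (UU m ×ˢ SS n) := by
  rintro ⟨f, g⟩ ⟨⟨hf, _⟩, hg⟩ ⟨f', g'⟩ ⟨⟨hf', _⟩, hg'⟩ h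
  simp only at hf hf' hg hg'
  have h' := fun i => congrFun h i
  simp only [glue] at h'
  refine Prod.ext (funext fun i => ?_) (funext fun i => ?_)
  · by_cases hi : i ≤ m
    · simpa [hi] using h' i
    · simp [hf.2.1 i (by omega), hf'.2.1 i (by omega)]
  · have := h' (i + (m + 1))
    simpa [show ¬ (i + (m + 1) ≤ m) by omega] using this

theorem conv (n : ℕ) : a (n + 1) = ∑ m ∈ Finset.range (n + 1), (UU m).ncard * a (n - m) := by
  classical
  rw [a_eq, Set.ncard_eq_toFinset_card _ (ss_finite (n + 1)),
    Finset.card_eq_sum_card_fiberwise (f := fun f => f 0) (t := Finset.range (n + 1))]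
  · apply Finset.sum_congr rfl
    intro m hm
    have hm' : m ≤ n := by simpa [Nat.lt_succ_iff] using hm
    rw [a_eq, ← Set.ncard_prod, ← (glue_inj (n - m) m).ncard_image, ← fiber n m hm',
      ← Set.ncard_coe_finset]
    congr 1
    ext f
    simp
  · intro f hf
    simp only [Set.Finite.coe_toFinset] at hf
    simpa using ss_lt hf (i := 0) (by omega)

/-- A map of order 3 that is decreasing on an invariant set has at most one point there. -/
theorem dec3 (f : ℕ → ℕ) (h3 : ∀ i, f (f (f i)) = i) (s : ℕ → Prop) (hs : ∀ i, s i → s (f i))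
    (hd : ∀ i j, s i → s j → i < j → f j < f i) (x y : ℕ) (hx : s x) (hy : s y) : x = y := by
  have fx : ∀ x, s x → f x = x := by
    intro x hx
    have h1 := hs x hx
    have h2 := hs _ h1
    have a1 := hd x (f x) hx h1
    have a2 := hd (f x) x h1 hx
    have a3 := hd x (f (f x)) hx h2
    have a4 := hd (f (f x)) x h2 hx
    have a5 := hd (f x) (f (f x)) h1 h2
    have a6 := hd (f (f x)) (f x) h2 h1
    rw [h3] at a3 a4 a5 a6
    have a7 : f (f x) = f x → f x = x := fun h => by
      have := h3 x; rw [h, h] at this; exact this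
    have a8 : f (f x) = x → f x = x := fun h => by
      have := h3 x; rw [h] at this; exact this
    omega
  have a1 := hd x y hx hy
  have a2 := hd y x hy hx
  rw [fx x hx, fx y hy] at a1 a2
  omega

theorem uu_second {L : ℕ} (hL : 5 ≤ L) {f : ℕ → ℕ} (hf : f ∈ UU L) : f 1 = L - 1 := by
  obtain ⟨hf, h0⟩ := hf
  have h3 := hf.1
  have hav := hf.2.2
  have inj : ∀ x y, f x = f y → x = y := fun x y h => ss_inj hf h
  have lt : ∀ x, x ≤ L → f x ≤ L := fun x hx => by
    have := ss_lt hf (i := x) (by omega); omega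
  obtain ⟨j, hj⟩ : ∃ j, f L = j := ⟨_, rfl⟩
  have hj0 : f j = 0 := by rw [← hj, ← h0, h3]
  have jL : j ≤ L := hj ▸ lt L le_rfl
  have jne0 : j ≠ 0 := by rintro rfl; omega
  have jneL : j ≠ L := by intro h; rw [h] at hj0 hj; omega
  have D1 : ∀ i i', i < i' → i' < j → f i' < f i := by
    intro i i' h1 h2
    by_contra h
    have n1 : f i ≠ f i' := fun h => by have := inj _ _ h; omega
    have n2 : f i ≠ f j := fun h => by have := inj _ _ h; omega
    exact hav i i' j h1 h2 (by omega) (by omega)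
  have D3 : ∀ i i', i < i' → i' < L → j < f i → f i' < f i := by
    intro i i' h1 h2 h4
    by_contra h
    have n1 : f i ≠ f i' := fun h => by have := inj _ _ h; omega
    exact hav i i' L h1 h2 (by omega) (by omega)
  by_contra hne
  -- the block `[1, j)` is invariant
  have blk : ∀ i, 1 ≤ i → i < j → 1 ≤ f i ∧ f i < j := by
    intro i hi hij
    have n0 : f i ≠ f j := fun h => by have := inj _ _ h; omega
    have nL : f i ≠ f 0 := fun h => by have := inj _ _ h; omega
    have nj : f i ≠ f L := fun h => by have := inj _ _ h; omega
    have := lt i (by omega)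
    refine ⟨by omega, ?_⟩
    by_contra hge
    -- position of `L - 1`
    obtain ⟨p, hp⟩ : ∃ p, f p = L - 1 := ⟨f (f (L - 1)), h3 _⟩
    have pL : p ≤ L := by
      by_contra h
      have := hf.2.1 p (by omega)
      omega
    have p0 : p ≠ 0 := by rintro rfl; omega
    have p1 : p ≠ 1 := by rintro rfl; omega
    have pj : p ≠ j := by rintro rfl; omega
    have pL' : p ≠ L := by rintro rfl; omega
    have l1 := lt 1 (by omega)
    have n1 : f 1 ≠ f 0 := fun h => by have := inj _ _ h; omega
    by_cases hpj : p < j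
    · have := D1 1 p (by omega) hpj
      omega
    · have := D3 i p (by omega) (by omega) (by omega)
      omega
  have blk' : ∀ i, j < i → i < L → j < f i ∧ f i < L := by
    intro i hi hij
    have n0 : f i ≠ f j := fun h => by have := inj _ _ h; omega
    have nL : f i ≠ f 0 := fun h => by have := inj _ _ h; omega
    have nj : f i ≠ f L := fun h => by have := inj _ _ h; omega
    have := lt i (by omega)
    refine ⟨?_, by omega⟩
    by_contra hge
    have b1 := blk (f i) (by omega) (by omega)
    have b2 := blk _ b1.1 b1.2
    rw [h3] at b2
    omega
  have s1 := dec3 f h3 (fun i => 1 ≤ i ∧ i < j) (fun i hi => blk i hi.1 hi.2)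
    (fun i i' hi hi' h => D1 i i' h hi'.2)
  have s2 := dec3 f h3 (fun i => j < i ∧ i < L) (fun i hi => blk' i hi.1 hi.2)
    (fun i i' hi hi' h => D3 i i' h hi'.2 (blk' i hi.1 hi.2).1)
  have t1 := s1 1 2
  have t2 := s2 (j + 1) (j + 2)
  omega

theorem uu_adj {L : ℕ} (hL : 5 ≤ L) {f : ℕ → ℕ} (hf : f ∈ UU L) :
    2 ≤ f L ∧ f L < L - 1 ∧ 2 ≤ f (L - 1) ∧ f (L - 1) < L - 1 ∧
    (f (L - 1) = f L + 1 ∨ f L = f (L - 1) + 1) := by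
  have h1 := uu_second hL hf
  obtain ⟨hf, h0⟩ := hf
  have h3 := hf.1
  have hav := hf.2.2
  have inj : ∀ x y, f x = f y → x = y := fun x y h => ss_inj hf h
  have lt : ∀ x, x ≤ L → f x ≤ L := fun x hx => by
    have := ss_lt hf (i := x) (by omega); omega
  obtain ⟨j, hj⟩ : ∃ j, f L = j := ⟨_, rfl⟩
  obtain ⟨j', hj'⟩ : ∃ j, f (L - 1) = j := ⟨_, rfl⟩
  have hj0 : f j = 0 := by rw [← hj, ← h0, h3]
  have hj1 : f j' = 1 := by rw [← hj', ← h1, h3]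
  have jL : j ≤ L := hj ▸ lt L le_rfl
  have jL' : j' ≤ L := hj' ▸ lt (L - 1) (by omega)
  have jne0 : j ≠ 0 := by rintro rfl; omega
  have jne1 : j ≠ 1 := by rintro rfl; omega
  have jneL : j ≠ L := by intro h; rw [h] at hj0 hj; omega
  have jne0' : j' ≠ 0 := by rintro rfl; omega
  have jne1' : j' ≠ 1 := by rintro rfl; omega
  have jneL' : j' ≠ L - 1 := by intro h; rw [h] at hj1 hj'; omega
  have jneL2 : j ≠ L - 1 := by intro h; rw [h] at hj0; rw [hj0] at hj'; omega
  have jneL2' : j' ≠ L := by intro h; rw [h] at hj1; rw [hj1] at hj; omega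
  have jj : j ≠ j' := by rintro rfl; omega
  rw [hj, hj']
  refine ⟨by omega, by omega, by omega, by omega, ?_⟩
  by_contra hcon
  obtain ⟨x, hx⟩ : ∃ x, (j < x ∧ x < j') ∨ (j' < x ∧ x < j) := by
    by_cases h : j < j'
    · exact ⟨j + 1, by omega⟩
    · exact ⟨j' + 1, by omega⟩
  have nrm : ∀ z, 2 ≤ z → z < L - 1 → z ≠ j → z ≠ j' →
      2 ≤ f z ∧ f z < L - 1 ∧ f z ≠ j ∧ f z ≠ j' := by
    intro z z1 z2 z3 z4
    have n0 : f z ≠ f j := fun h => by have := inj _ _ h; omega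
    have n1 : f z ≠ f j' := fun h => by have := inj _ _ h; omega
    have n2 : f z ≠ f 0 := fun h => by have := inj _ _ h; omega
    have n3 : f z ≠ f 1 := fun h => by have := inj _ _ h; omega
    have n4 : f z ≠ f L := fun h => by have := inj _ _ h; omega
    have n5 : f z ≠ f (L - 1) := fun h => by have := inj _ _ h; omega
    have := lt z (by omega)
    omega
  obtain ⟨y, hy⟩ : ∃ y, f x = y := ⟨_, rfl⟩
  obtain ⟨z, hz⟩ : ∃ z, f y = z := ⟨_, rfl⟩
  have hzx : f z = x := by rw [← hz, ← hy, h3]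
  have nx := nrm x (by omega) (by omega) (by omega) (by omega)
  rw [hy] at nx
  have ny := nrm y (by omega) (by omega) (by omega) (by omega)
  rw [hz] at ny
  rcases hx with hx | hx
  · exact hav z (L - 1) L (by omega) (by omega) (by omega) (by omega)
  · exact hav j' x j (by omega) (by omega) (by omega) (by omega)

def ee (j i : ℕ) : ℕ := if i + 1 < j then i + 1 else i + 2
def rr (j x : ℕ) : ℕ := if x < j then x - 1 else x - 2

theorem rr_ee (j i : ℕ) : rr j (ee j i) = i := by
  unfold rr ee; split_ifs <;> omega

theorem ee_rr (j x : ℕ) (hj : 1 ≤ j) (hx : 1 ≤ x) (hxj : x ≠ j) : ee j (rr j x) = x := by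
  unfold rr ee; split_ifs <;> omega

theorem ee_lt (j a b : ℕ) (h : a < b) : ee j a < ee j b := by
  unfold ee; split_ifs <;> omega

theorem ee_lt_iff (j a b : ℕ) : ee j a < ee j b ↔ a < b := by
  constructor
  · unfold ee; split_ifs <;> omega
  · exact ee_lt j a b

theorem rr_lt (j x y : ℕ) (hj : 1 ≤ j) (hx : 1 ≤ x) (hxj : x ≠ j) (hyj : y ≠ j) (h : x < y) :
    rr j x < rr j y := by
  unfold rr; split_ifs <;> omega

theorem ee_bd (M j i : ℕ) (hj : 1 ≤ j) (hi : i ≤ M) :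
    1 ≤ ee j i ∧ ee j i ≤ M + 2 ∧ ee j i ≠ j := by
  unfold ee; split_ifs <;> omega

theorem rr_bd (M j x : ℕ) (hj : j ≤ M + 2) (hx : 1 ≤ x) (hxM : x ≤ M + 2) (hxj : x ≠ j) :
    rr j x ≤ M := by
  unfold rr; split_ifs <;> omega

/-- Insert the cycle `0 → M + 3 → j → 0`. -/
def ins (M j : ℕ) (g : ℕ → ℕ) (x : ℕ) : ℕ :=
  if x = 0 then M + 3 else if x = M + 3 then j else if x = j then 0 else
    if M + 3 < x then x else ee j (g (rr j x))

/-- Delete that cycle. -/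
def del (M j : ℕ) (f : ℕ → ℕ) (i : ℕ) : ℕ := if i ≤ M then rr j (f (ee j i)) else i

theorem ins_norm (M j : ℕ) (g : ℕ → ℕ) (x : ℕ) (h1 : 1 ≤ x) (h2 : x ≤ M + 2) (h3 : x ≠ j) :
    ins M j g x = ee j (g (rr j x)) := by
  unfold ins
  rw [if_neg (by omega), if_neg (by omega), if_neg h3, if_neg (by omega)]

theorem ins_mem {M : ℕ} (hM : 2 ≤ M) {g : ℕ → ℕ} (hg : g ∈ UU M) (j : ℕ)
    (hj : j = g M + 1 ∨ j = g M + 2) : ins M j g ∈ UU (M + 3) := by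
  obtain ⟨hg, g0⟩ := hg
  have inj : ∀ x y, g x = g y → x = y := fun x y h => ss_inj hg h
  have lt : ∀ x, x ≤ M → g x ≤ M := fun x hx => by
    have := ss_lt hg (i := x) (by omega); omega
  obtain ⟨q, hq⟩ : ∃ q, g M = q := ⟨_, rfl⟩
  rw [hq] at hj
  have gq : g q = 0 := by rw [← hq, ← g0, hg.1]
  have q0 : q ≠ 0 := by rintro rfl; omega
  have qM : q < M := by
    have := lt M le_rfl
    have : q ≠ M := by rintro h; rw [h] at gq; omega
    omega
  have j2 : 2 ≤ j := by omega
  have jM : j ≤ M + 1 := by omega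
  have f0 : ins M j g 0 = M + 3 := by simp [ins]
  have fL : ins M j g (M + 3) = j := by simp [ins]
  have fj : ins M j g j = 0 := by
    unfold ins; rw [if_neg (by omega), if_neg (by omega), if_pos rfl]
  have fb : ∀ x, M + 3 < x → ins M j g x = x := fun x hx => by
    unfold ins; rw [if_neg (by omega), if_neg (by omega), if_neg (by omega), if_pos hx]
  have fn := ins_norm M j g
  have bd : ∀ x, 1 ≤ x → x ≤ M + 2 → x ≠ j → 1 ≤ ins M j g x ∧ ins M j g x ≤ M + 2 ∧
      ins M j g x ≠ j ∧ rr j (ins M j g x) = g (rr j x) := by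
    intro x h1 h2 h3
    have b := rr_bd M j x (by omega) h1 h2 h3
    have c := ee_bd M j (g (rr j x)) (by omega) (lt _ b)
    rw [fn x h1 h2 h3]
    exact ⟨c.1, c.2.1, c.2.2, rr_ee _ _⟩
  refine ⟨⟨?_, ?_, ?_⟩, f0⟩
  · intro x
    by_cases x0 : x = 0
    · rw [x0, f0, fL, fj]
    by_cases xL : x = M + 3
    · rw [xL, fL, fj, f0]
    by_cases xj : x = j
    · rw [xj, fj, f0, fL]
    by_cases xb : M + 3 < x
    · rw [fb x xb, fb x xb, fb x xb]
    have b1 := bd x (by omega) (by omega) xj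
    have b2 := bd _ b1.1 b1.2.1 b1.2.2.1
    rw [fn _ b2.1 b2.2.1 b2.2.2.1, b2.2.2.2, b1.2.2.2, hg.1, ee_rr _ _ (by omega) (by omega) xj]
  · intro i hi
    exact fb i (by omega)
  · intro i i' k hii hik h1 h2
    have le : ∀ x, x ≤ M + 3 → ins M j g x ≤ M + 3 := by
      intro x hx
      by_cases x0 : x = 0
      · rw [x0, f0]
      by_cases xL : x = M + 3
      · rw [xL, fL]; omega
      by_cases xj : x = j
      · rw [xj, fj]; omega
      have := bd x (by omega) (by omega) xj
      omega
    have kL : k ≤ M + 3 := by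
      by_contra h
      rw [fb k (by omega)] at h1
      by_cases hi : i ≤ M + 3
      · have := le i hi; omega
      · rw [fb i (by omega)] at h1; omega
    have i0 : i ≠ 0 := by
      rintro rfl
      have := le i' (by omega)
      omega
    have ij : i ≠ j := by rintro rfl; omega
    have ij' : i' ≠ j := by rintro rfl; omega
    have bi := bd i (by omega) (by omega) ij
    have ri := rr_bd M j i (by omega) (by omega) (by omega) ij
    have ri' := rr_bd M j i' (by omega) (by omega) (by omega) ij'
    have hlt := rr_lt j i i' (by omega) (by omega) ij ij' hii
    have glt : g (rr j i) < g (rr j i') := by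
      rw [fn i (by omega) (by omega) ij, fn i' (by omega) (by omega) ij', ee_lt_iff] at h2
      exact h2
    by_cases kj : k = j
    · -- the value `0` is the last entry of the pattern
      rw [kj] at hik
      have r1 : rr j i' ≤ q := by unfold rr; split_ifs <;> omega
      have r2 : rr j i' ≠ q := fun h => by rw [h, gq] at glt; omega
      have r3 : g (rr j i) ≠ 0 := fun h => by
        have := inj _ _ (h.trans gq.symm); omega
      exact hg.2.2 _ _ q hlt (by omega) (by omega) glt
    by_cases kL' : k = M + 3
    · rw [kL', fL, fn i (by omega) (by omega) ij] at h1
      have r1 : q ≤ g (rr j i) := by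
        unfold ee at h1; split_ifs at h1 <;> omega
      have r2 : g (rr j i) ≠ q := fun h => by
        have := inj _ _ (h.trans hq.symm); omega
      have r3 : rr j i' ≠ M := fun h => by rw [h, hq] at glt; omega
      exact hg.2.2 _ _ M hlt (by omega) (by omega) glt
    · have hlt' := rr_lt j i' k (by omega) (by omega) ij' kj hik
      rw [fn i (by omega) (by omega) ij, fn k (by omega) (by omega) kj, ee_lt_iff] at h1
      exact hg.2.2 _ _ _ hlt hlt' h1 glt

theorem del_mem {M : ℕ} (hM : 2 ≤ M) {f : ℕ → ℕ} (hf : f ∈ UU (M + 3)) :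
    del M (f (M + 3)) f ∈ UU M ∧ ins M (f (M + 3)) (del M (f (M + 3)) f) = f ∧
    (f (M + 3) = del M (f (M + 3)) f M + 1 ∨ f (M + 3) = del M (f (M + 3)) f M + 2) := by
  have hs := uu_second (by omega) hf
  have ha := uu_adj (by omega) hf
  obtain ⟨hf, h0⟩ := hf
  have h3 := hf.1
  have inj : ∀ x y, f x = f y → x = y := fun x y h => ss_inj hf h
  obtain ⟨j, hj⟩ : ∃ j, f (M + 3) = j := ⟨_, rfl⟩
  have hj0 : f j = 0 := by rw [← hj, ← h0, h3]
  simp only [show M + 3 - 1 = M + 2 by omega] at hs ha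
  rw [hj] at ha ⊢
  have nrm : ∀ z, 1 ≤ z → z ≤ M + 2 → z ≠ j → 1 ≤ f z ∧ f z ≤ M + 2 ∧ f z ≠ j := by
    intro z z1 z2 z3
    have n0 : f z ≠ f j := fun h => by have := inj _ _ h; omega
    have n2 : f z ≠ f 0 := fun h => by have := inj _ _ h; omega
    have n4 : f z ≠ f (M + 3) := fun h => by have := inj _ _ h; omega
    have := ss_lt hf (i := z) (by omega)
    omega
  have dn : ∀ i, i ≤ M → del M j f i = rr j (f (ee j i)) := fun i hi => by simp [del, hi]
  have db : ∀ i, M < i → del M j f i = i := fun i hi => by simp [del, not_le.mpr hi]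
  have key : ∀ i, i ≤ M → del M j f i ≤ M ∧ ee j (del M j f i) = f (ee j i) := by
    intro i hi
    have e := ee_bd M j i (by omega) hi
    have n := nrm _ e.1 e.2.1 e.2.2
    rw [dn i hi]
    exact ⟨rr_bd M j _ (by omega) n.1 n.2.1 n.2.2, ee_rr _ _ (by omega) n.1 n.2.2⟩
  refine ⟨⟨⟨?_, ?_, ?_⟩, ?_⟩, ?_, ?_⟩
  · intro i
    by_cases hi : i ≤ M
    · have k1 := key i hi
      have k2 := key _ k1.1
      rw [dn _ k2.1, k2.2, k1.2, h3, rr_ee]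
    · rw [db i (by omega), db i (by omega), db i (by omega)]
  · intro i hi
    exact db i (by omega)
  · intro i i' k a1 a2 a3 a4
    by_cases hk : k ≤ M
    · have k1 := key i (by omega)
      have k2 := key i' (by omega)
      have k3 := key k hk
      rw [← ee_lt_iff j, k3.2, k1.2] at a3
      rw [← ee_lt_iff j, k1.2, k2.2] at a4
      exact hf.2.2 _ _ _ (ee_lt j _ _ a1) (ee_lt j _ _ a2) a3 a4
    · rw [db k (by omega)] at a3
      by_cases hi : i ≤ M
      · have := key i hi; omega
      · rw [db i (by omega)] at a3; omega
  · rw [dn 0 (by omega), show ee j 0 = 1 by unfold ee; rw [if_pos (by omega)], hs]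
    unfold rr; split_ifs <;> omega
  · funext x
    by_cases x0 : x = 0
    · rw [x0, h0]; simp [ins]
    by_cases xL : x = M + 3
    · rw [xL, hj]; simp [ins]
    by_cases xj : x = j
    · rw [xj, hj0]; unfold ins; rw [if_neg (by omega), if_neg (by omega), if_pos rfl]
    by_cases xb : M + 3 < x
    · unfold ins
      rw [if_neg x0, if_neg xL, if_neg xj, if_pos xb, hf.2.1 x (by omega)]
    rw [ins_norm _ _ _ _ (by omega) (by omega) xj,
      (key _ (rr_bd M j x (by omega) (by omega) (by omega) xj)).2,
      ee_rr _ _ (by omega) (by omega) xj]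
  · rw [dn M le_rfl, show ee j M = M + 2 by unfold ee; rw [if_neg (by omega)]]
    unfold rr; split_ifs <;> omega

theorem uu_rec (M : ℕ) (hM : 2 ≤ M) : (UU (M + 3)).ncard = 2 * (UU M).ncard := by
  have himg : UU (M + 3) = (fun p : (ℕ → ℕ) × ℕ => ins M (p.1 M + p.2) p.1) ''
      (UU M ×ˢ ({1, 2} : Set ℕ)) := by
    ext f
    constructor
    · intro hf
      obtain ⟨h1, h2, h4⟩ := del_mem hM hf
      rcases h4 with h4 | h4
      · refine ⟨(del M (f (M + 3)) f, 1), ⟨h1, by simp⟩, ?_⟩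
        simp only
        rw [← h4]
        exact h2
      · refine ⟨(del M (f (M + 3)) f, 2), ⟨h1, by simp⟩, ?_⟩
        simp only
        rw [← h4]
        exact h2
    · rintro ⟨⟨g, b⟩, ⟨hg, hb⟩, rfl⟩
      simp only [Set.mem_insert_iff, Set.mem_singleton_iff] at hg hb
      apply ins_mem hM hg
      simp only
      omega
  rw [himg, Set.InjOn.ncard_image, Set.ncard_prod, Set.ncard_pair (by norm_num), mul_comm]
  rintro ⟨g, b⟩ ⟨hg, hb⟩ ⟨g', b'⟩ ⟨hg', hb'⟩ h
  simp only [Set.mem_insert_iff, Set.mem_singleton_iff] at hg hb hg' hb' h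
  have hjj : g M + b = g' M + b' := by
    have := congrFun h (M + 3)
    simpa [ins] using this
  rw [← hjj] at h
  have hgg : g = g' := by
    funext i
    by_cases hi : i ≤ M
    · have e := ee_bd M (g M + b) i (by omega) hi
      have := congrFun h (ee (g M + b) i)
      rw [ins_norm _ _ _ _ e.1 e.2.1 e.2.2, ins_norm _ _ _ _ e.1 e.2.1 e.2.2, rr_ee] at this
      have := congrArg (rr (g M + b)) this
      rwa [rr_ee, rr_ee] at this
    · rw [hg.1.2.1 i (by omega), hg'.1.2.1 i (by omega)]
  subst hgg
  have : b = b' := by omega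
  rw [this]

theorem recurrence_231_order3 :
    a 0 = 1 ∧ a 1 = 1 ∧ a 2 = 1 ∧ a 3 = 2 ∧ a 4 = 5 ∧ a 5 = 9 ∧
    ∀ n, 6 ≤ n → a n = a (n - 1) + 3 * a (n - 3) + a (n - 5) := by
  obtain ⟨a0, a1, a2, a3, a4, a5⟩ := small
  refine ⟨a0, a1, a2, a3, a4, a5, ?_⟩
  have c0 := conv 0
  have c1 := conv 1
  have c2 := conv 2
  have c3 := conv 3
  have c4 := conv 4
  simp only [Finset.sum_range_succ, Finset.sum_range_zero, Nat.reduceAdd, Nat.reduceSub,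
    a0, a1, a2, a3, a4, a5] at c0 c1 c2 c3 c4
  have u0 : (UU 0).ncard = 1 := by omega
  have u1 : (UU 1).ncard = 0 := by omega
  have u2 : (UU 2).ncard = 1 := by omega
  have u3 : (UU 3).ncard = 2 := by omega
  have u4 : (UU 4).ncard = 1 := by omega
  intro n hn
  obtain ⟨n, rfl⟩ : ∃ k, n = k + 6 := ⟨n - 6, by omega⟩
  have e1 := conv (n + 5)
  have e2 := conv (n + 2)
  rw [Finset.sum_range_succ', Finset.sum_range_succ', Finset.sum_range_succ',
    Finset.sum_range_succ', Finset.sum_range_succ'] at e1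
  rw [Finset.sum_range_succ', Finset.sum_range_succ'] at e2
  have hs : ∑ m ∈ Finset.range (n + 1), (UU (m + 1 + 1 + 1 + 1 + 1)).ncard *
        a (n + 5 - (m + 1 + 1 + 1 + 1 + 1))
      = 2 * ∑ m ∈ Finset.range (n + 1), (UU (m + 1 + 1)).ncard * a (n + 2 - (m + 1 + 1)) := by
    rw [Finset.mul_sum]
    apply Finset.sum_congr rfl
    intro m _
    rw [show m + 1 + 1 + 1 + 1 + 1 = (m + 2) + 3 by ring, uu_rec _ (by omega),
      show n + 5 - (m + 2 + 3) = n + 2 - (m + 1 + 1) by omega, mul_assoc]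
  rw [hs] at e1
  simp only [zero_add, Nat.reduceAdd, u0, u1, u2, u3, u4] at e1 e2
  simp only [show n + 5 + 1 = n + 6 by omega, show n + 2 + 1 = n + 3 by omega,
    show n + 5 - 4 = n + 1 by omega, show n + 5 - 3 = n + 2 by omega,
    show n + 5 - 2 = n + 3 by omega, show n + 5 - 0 = n + 5 by omega,
    show n + 2 - 0 = n + 2 by omega] at e1 e2
  simp only [show n + 6 - 1 = n + 5 by omega, show n + 6 - 3 = n + 3 by omega,
    show n + 6 - 5 = n + 1 by omega]
  omega
end

section
/- The number of order-3 permutations of [n] avoiding 132 is at most the number of order-3 permutations of [n] avoiding 321, for each n with 1 ≤ n ≤ 12. (Verify computationally/constructively for these small cases: the counts are 1,1,3,5,7,17,31,49,107,201,339,699 for 132 versus 1,1,3,5,7,19,35,55,139,267,447,1075 for 321.) -/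
def Avoids132 {n : ℕ} (π : Equiv.Perm (Fin n)) : Prop :=
  ¬ ∃ i j k : Fin n, i < j ∧ j < k ∧ π i < π k ∧ π k < π j

def Avoids321 {n : ℕ} (π : Equiv.Perm (Fin n)) : Prop :=
  ¬ ∃ i j k : Fin n, i < j ∧ j < k ∧ π j < π i ∧ π k < π j

/-- Partial assignments: entry `p` is the value at position `p`, `0` meaning unassigned.
Positions and values are `1, …, n`; entry `0` is a dummy. -/
abbrev PSt := List ℕ

/-- `updK E p v k = k (E.set p v)`, in continuation passing style. -/
noncomputable def updK {β : Type} (E : PSt) : ℕ → ℕ → (PSt → β) → β :=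
  List.rec (motive := fun _ => ℕ → ℕ → (PSt → β) → β) (fun _ _ k => k [])
    (fun x t ih p v k =>
      Nat.rec (motive := fun _ => β) (k (v :: t)) (fun q _ => ih q v (fun t' => k (x :: t'))) p) E

noncomputable def eraseK {β : Type} (l : List ℕ) : ℕ → (List ℕ → β) → β :=
  List.rec (motive := fun _ => ℕ → (List ℕ → β) → β) (fun _ k => k [])
    (fun x t ih a k =>
      Bool.rec (motive := fun _ => β) (ih a (fun t' => k (x :: t'))) (k t) (Nat.beq x a)) l

noncomputable def bsel {β : Type} (b : Bool) (x y : β) : β :=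
  Bool.rec (motive := fun _ => β) y x b

local notation "sel(" b "," x "," y ")" => @Bool.rec (fun _ => Bool) y x b

noncomputable def chkR132 (v mn : ℕ) (E : PSt) : ℕ → Bool :=
  List.rec (motive := fun _ => ℕ → Bool) (fun _ => true)
    (fun w _ ih m =>
      sel(Nat.ble w v, sel(Nat.ble w mn, ih m, false), sel(Nat.ble m w, ih w, false))) E

noncomputable def chk132 (v : ℕ) (E : PSt) : ℕ → ℕ → Bool :=
  List.rec (motive := fun _ => ℕ → ℕ → Bool) (fun _ _ => true)
    (fun w t ih p mn =>
      Nat.rec (motive := fun _ => Bool) (chkR132 v mn t v)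
        (fun q _ => sel(Nat.ble w v,
          sel(Nat.beq w 0, ih q mn, sel(Nat.ble mn w, ih q mn, ih q w)),
          sel(Nat.ble v mn, ih q mn, false))) p) E

noncomputable def av132 (E : PSt) (p v : ℕ) : Bool := chk132 v E p 100

noncomputable def chkR321 (v s : ℕ) (E : PSt) : ℕ → Bool :=
  List.rec (motive := fun _ => ℕ → Bool) (fun _ => true)
    (fun w _ ih m =>
      sel(Nat.beq w 0, ih m, sel(Nat.ble v w, ih m,
        sel(Nat.beq s 0, sel(Nat.ble m w, ih w, false), false)))) E

noncomputable def chk321 (v : ℕ) (E : PSt) : ℕ → ℕ → Bool :=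
  List.rec (motive := fun _ => ℕ → ℕ → Bool) (fun _ _ => true)
    (fun w t ih p m =>
      Nat.rec (motive := fun _ => Bool) (chkR321 v m t 0)
        (fun q _ => sel(Nat.ble w v, ih q m, sel(Nat.ble m w, ih q w, false))) p) E

noncomputable def av321 (E : PSt) (p v : ℕ) : Bool := chk321 v E p 0

noncomputable def fo {β : Type} (f : ℕ → List β → List β) (l : List ℕ) (acc : List β) : List β :=
  List.rec (motive := fun _ => List β) acc (fun a _ ih => f a ih) l

/-- Set position `p` to `v` if the test allows it. -/
noncomputable def tryK (av : PSt → ℕ → ℕ → Bool) (E : PSt) (p v : ℕ)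
    (c : PSt → List PSt → List PSt) (acc : List PSt) : List PSt :=
  bsel (av E p v) (updK E p v (fun E' => c E' acc)) acc

/-- Backtracking search, one cycle at a time. -/
noncomputable def srchK (av : PSt → ℕ → ℕ → Bool) (m : ℕ) :
    List ℕ → PSt → List PSt → List PSt :=
  Nat.rec (motive := fun _ => List ℕ → PSt → List PSt → List PSt) (fun _ E acc => E :: acc)
    (fun _ ih U E acc =>
      List.rec (motive := fun _ => List PSt) (E :: acc)
        (fun i rest _ =>
          tryK av E i i (fun E1 => ih rest E1)
            (fo (fun j => tryK av E i j (fun E1 =>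
                eraseK rest j (fun U1 =>
                  fo (fun k => tryK av E1 j k (fun E2 => tryK av E2 k i (fun E3 =>
                    eraseK U1 k (fun U2 => ih U2 E3)))) U1)))
              rest acc)) U) m

noncomputable def lookD (E : PSt) : ℕ → ℕ :=
  List.rec (motive := fun _ => ℕ → ℕ) (fun _ => 0)
    (fun x _ ih p => Nat.rec (motive := fun _ => ℕ) x (fun q _ => ih q) p) E

/-- Full test for 321 (no zero entries). -/
noncomputable def full321 (E : PSt) : Bool :=
  List.rec (motive := fun _ => Bool) true
    (fun v t ih => bsel (chkR321 v 0 t 0) ih false) E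

noncomputable def allB (f : ℕ → Bool) (l : List ℕ) : Bool :=
  List.rec (motive := fun _ => Bool) true (fun a _ ih => bsel (f a) ih false) l

noncomputable def good (n : ℕ) (U : List ℕ) (E : PSt) : Bool :=
  bsel (allB (fun p => bsel (Nat.ble 1 (lookD E p)) (bsel (Nat.ble (lookD E p) n)
    (Nat.beq (lookD E (lookD E (lookD E p))) p) false) false) U) (full321 E) false

/-- At least `N` entries satisfy `f`. -/
noncomputable def cntGE (f : PSt → Bool) (l : List PSt) : ℕ → Bool :=
  List.rec (motive := fun _ => ℕ → Bool) (fun N => Nat.beq N 0)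
    (fun a _ ih N => Nat.rec (motive := fun _ => Bool) true
      (fun q _ => sel(f a, ih q, ih N)) N) l

/-- The length is at most `N`. -/
noncomputable def lenLE (l : List PSt) : ℕ → Bool :=
  List.rec (motive := fun _ => ℕ → Bool) (fun _ => true)
    (fun _ _ ih N => Nat.rec (motive := fun _ => Bool) false (fun q _ => ih q) N) l

def U0 (n : ℕ) : List ℕ := (List.range (n + 1)).tail

def E0 (n : ℕ) : PSt := List.replicate (n + 1) 0

/-! ### The search in plain form -/

theorem bsel_eq {β : Type} (b : Bool) (x y : β) : bsel b x y = if b then x else y := by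
  cases b <;> rfl

theorem sel_eq (b x y : Bool) : sel(b, x, y) = if b then x else y := by
  cases b <;> rfl

theorem updK_eq {β : Type} (E : PSt) : ∀ (p v : ℕ) (k : PSt → β),
    updK E p v k = k (E.set p v) := by
  induction E with
  | nil => intro p v k; rfl
  | cons x t ih =>
    intro p v k
    cases p with
    | zero => rfl
    | succ q => exact ih q v (fun t' => k (x :: t'))

theorem eraseK_eq {β : Type} (l : List ℕ) : ∀ (a : ℕ) (k : List ℕ → β),
    eraseK l a k = k (l.erase a) := by
  induction l with
  | nil => intro a k; rfl
  | cons x t ih =>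
    intro a k
    have h : eraseK (x :: t) a k =
      bsel (Nat.beq x a) (k t) (eraseK t a (fun t' => k (x :: t'))) := rfl
    rw [h, bsel_eq, ih, List.erase_cons]
    by_cases hx : x = a
    · simp [hx]
    · simp [hx]

theorem fo_eq {β : Type} (f : ℕ → List β → List β) (g : ℕ → List β)
    (h : ∀ a acc, f a acc = g a ++ acc) (l : List ℕ) (acc : List β) :
    fo f l acc = l.flatMap g ++ acc := by
  induction l with
  | nil => rfl
  | cons a t ih =>
    have h' : fo f (a :: t) acc = f a (fo f t acc) := rfl
    rw [h', h, ih]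
    simp

theorem tryK_eq (av : PSt → ℕ → ℕ → Bool) (E : PSt) (p v : ℕ)
    (c : PSt → List PSt → List PSt) (d : PSt → List PSt)
    (h : ∀ E' acc, c E' acc = d E' ++ acc) (acc : List PSt) :
    tryK av E p v c acc = (if av E p v then d (E.set p v) else []) ++ acc := by
  unfold tryK
  rw [bsel_eq, updK_eq, h]
  split_ifs <;> simp

def srchS (av : PSt → ℕ → ℕ → Bool) : ℕ → List ℕ → PSt → List PSt
  | 0, _, E => [E]
  | _ + 1, [], E => [E]
  | m + 1, i :: rest, E =>
    (if av E i i then srchS av m rest (E.set i i) else []) ++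
      rest.flatMap fun j => if av E i j then
        (rest.erase j).flatMap fun k =>
          if av (E.set i j) j k then
            if av ((E.set i j).set j k) k i then
              srchS av m ((rest.erase j).erase k) (((E.set i j).set j k).set k i)
            else []
          else []
        else []

theorem srchK_eq (av : PSt → ℕ → ℕ → Bool) (m : ℕ) : ∀ (U : List ℕ) (E : PSt) (acc : List PSt),
    srchK av m U E acc = srchS av m U E ++ acc := by
  induction m with
  | zero => intro U E acc; rfl
  | succ m ih =>
    intro U E acc
    cases U with
    | nil => rfl
    | cons i rest =>
      have h : srchK av (m + 1) (i :: rest) E acc =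
          tryK av E i i (fun E1 => srchK av m rest E1)
            (fo (fun j => tryK av E i j (fun E1 =>
                eraseK rest j (fun U1 =>
                  fo (fun k => tryK av E1 j k (fun E2 => tryK av E2 k i (fun E3 =>
                    eraseK U1 k (fun U2 => srchK av m U2 E3)))) U1)))
              rest acc) := rfl
      rw [h, tryK_eq av E i i _ _ (fun E' acc => ih rest E' acc), srchS, List.append_assoc]
      congr 1
      apply fo_eq
      intro j acc
      refine tryK_eq av E i j _ (fun E1 => (rest.erase j).flatMap fun k =>
          if av E1 j k then
            if av (E1.set j k) k i then
              srchS av m ((rest.erase j).erase k) ((E1.set j k).set k i)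
            else []
          else []) ?_ acc
      intro E1 acc
      rw [eraseK_eq]
      apply fo_eq
      intro k acc
      refine tryK_eq av E1 j k _ (fun E2 => if av E2 k i then
              srchS av m ((rest.erase j).erase k) (E2.set k i)
            else []) ?_ acc
      intro E2 acc
      refine tryK_eq av E2 k i _ (fun E3 => srchS av m ((rest.erase j).erase k) E3) ?_ acc
      intro E3 acc
      rw [eraseK_eq, ih]

theorem lenLE_sound (l : List PSt) : ∀ N, lenLE l N = true → l.length ≤ N := by
  induction l with
  | nil => intro N _; simp
  | cons a t ih =>
    intro N h
    cases N with
    | zero => exact absurd (show false = true from h) (by decide)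
    | succ q =>
      have := ih q h
      simp; omega

theorem cntGE_sound (f : PSt → Bool) (l : List PSt) :
    ∀ N, cntGE f l N = true → N ≤ (l.filter f).length := by
  induction l with
  | nil =>
    intro N h
    have : N = 0 := Nat.eq_of_beq_eq_true h
    simp [this]
  | cons a t ih =>
    intro N h
    cases N with
    | zero => simp
    | succ q =>
      have h' : sel(f a, cntGE f t q, cntGE f t (q + 1)) = true := h
      rw [sel_eq] at h'
      by_cases hf : f a = true
      · simp only [hf, if_true] at h'
        have := ih q h'
        simp [hf]; omega
      · simp only [hf] at h'
        have := ih (q + 1) (by simpa using h')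
        simp [hf]; omega

theorem lookD_eq (E : PSt) : ∀ p, lookD E p = E.getD p 0 := by
  induction E with
  | nil => intro p; simp; rfl
  | cons x t ih =>
    intro p
    cases p with
    | zero => rfl
    | succ q =>
      have h : lookD (x :: t) (q + 1) = lookD t q := rfl
      rw [h, ih q]; simp

theorem getD_set (E : PSt) (p v q : ℕ) (hp : p < E.length) :
    (E.set p v).getD q 0 = if q = p then v else E.getD q 0 := by
  simp only [List.getD_eq_getElem?_getD, List.getElem?_set]
  by_cases h : p = q
  · subst h; simp [hp]
  · have h' : ¬ q = p := fun e => h e.symm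
    simp [h, h']

/-! ### Completeness of the search -/

theorem srchS_complete (av : PSt → ℕ → ℕ → Bool) (n : ℕ) (g : ℕ → ℕ)
    (hg : ∀ p, 1 ≤ p → p ≤ n → 1 ≤ g p ∧ g p ≤ n ∧ g (g (g p)) = p)
    (hav : ∀ (E : PSt) (p v : ℕ), (∀ q, E.getD q 0 ≠ 0 → E.getD q 0 = g q) →
      1 ≤ p → p ≤ n → g p = v → av E p v = true)
    (T : PSt) (hT : T.length = n + 1) (hTg : ∀ p, T.getD p 0 = g p) (hg0 : g 0 = 0) (m : ℕ) :
    ∀ (U : List ℕ) (E : PSt), E.length = n + 1 →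
      (∀ q, E.getD q 0 ≠ 0 → E.getD q 0 = g q) →
      (∀ p, p ∈ U ↔ (1 ≤ p ∧ p ≤ n ∧ E.getD p 0 = 0)) →
      U.Nodup → U.length ≤ m → (∀ p, p ∈ U → g p ∈ U) →
      T ∈ srchS av m U E := by
  have hend : ∀ E : PSt, E.length = n + 1 →
      (∀ q, E.getD q 0 ≠ 0 → E.getD q 0 = g q) →
      (∀ p, p ∈ ([] : List ℕ) ↔ (1 ≤ p ∧ p ≤ n ∧ E.getD p 0 = 0)) → T = E := by
    intro E hl hE hU
    apply List.ext_getElem (by omega)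
    intro p h1 h2
    have e1 : T.getD p 0 = T[p] := by simp [h1]
    have e2 : E.getD p 0 = E[p] := by simp [h2]
    rw [← e1, ← e2, hTg]
    by_cases h0 : E.getD p 0 = 0
    · by_cases hp : p = 0
      · subst hp; rw [h0, hg0]
      · exact absurd ((hU p).2 ⟨by omega, by omega, h0⟩) (by simp)
    · exact (hE p h0).symm
  have hset : ∀ (E : PSt) (p : ℕ), E.length = n + 1 → p ≤ n →
      (∀ q, E.getD q 0 ≠ 0 → E.getD q 0 = g q) →
      (∀ q, (E.set p (g p)).getD q 0 ≠ 0 → (E.set p (g p)).getD q 0 = g q) := by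
    intro E p hl hp hE q
    rw [getD_set _ _ _ _ (by omega)]
    split_ifs with h
    · intro _; rw [h]
    · exact hE q
  induction m with
  | zero =>
    intro U E hl hE hU _ hm _
    have : U = [] := List.length_eq_zero_iff.1 (by omega)
    subst this
    simp [srchS, hend E hl hE hU]
  | succ m ih =>
    intro U E hl hE hU hnd hm hcl
    cases U with
    | nil => simp [srchS, hend E hl hE hU]
    | cons i rest =>
      obtain ⟨hi1, hin, hi0⟩ := (hU i).1 (by simp)
      have hj := hcl i (by simp)
      have hk := hcl _ hj
      obtain ⟨hj1, hjn, hj0⟩ := (hU _).1 hj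
      obtain ⟨hk1, hkn, hk0⟩ := (hU _).1 hk
      have h3 := (hg i hi1 hin).2.2
      have hnd' := List.nodup_cons.1 hnd
      simp only [List.length_cons] at hm
      rw [srchS, List.mem_append]
      by_cases hij : g i = i
      · left
        rw [if_pos (hav E i i hE hi1 hin hij)]
        have hE1 := hset E i hl hin hE
        rw [hij] at hE1
        apply ih rest _ (by simpa using hl) hE1 _ hnd'.2 (by omega)
        · intro p hp
          have := hcl p (by simp [hp])
          rcases List.mem_cons.1 this with h | h
          · exfalso
            have hpp := (hU p).1 (by simp [hp])
            have e := (hg p hpp.1 hpp.2.1).2.2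
            rw [h, hij, hij] at e
            exact hnd'.1 (e ▸ hp)
          · exact h
        · intro p
          have := hU p
          rw [getD_set _ _ _ _ (by omega)]
          by_cases hpi : p = i
          · subst hpi
            simp [hnd'.1]; omega
          · simpa [hpi] using this
      · right
        generalize hjd : g i = j at *
        generalize hkd : g j = k at *
        have hjr : j ∈ rest := by
          rcases List.mem_cons.1 hj with h | h
          · exact absurd h hij
          · exact h
        have hkj : k ≠ j := by
          intro e; rw [e] at hkd h3; omega
        have hki : k ≠ i := by
          intro e; rw [e] at h3; omega
        have hkr : k ∈ rest.erase j := by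
          rw [hnd'.2.mem_erase_iff]
          refine ⟨hkj, ?_⟩
          rcases List.mem_cons.1 hk with h | h
          · exact absurd h hki
          · exact h
        have hE1 := hset E i hl hin hE
        rw [hjd] at hE1
        have hE2 := hset _ j (by simpa using hl) hjn hE1
        rw [hkd] at hE2
        have hE3 := hset _ k (by simpa using hl) hkn hE2
        rw [h3] at hE3
        rw [List.mem_flatMap]
        refine ⟨j, hjr, ?_⟩
        rw [if_pos (hav E i j hE hi1 hin hjd), List.mem_flatMap]
        refine ⟨k, hkr, ?_⟩
        rw [if_pos (hav _ j k hE1 hj1 hjn hkd), if_pos (hav _ k i hE2 hk1 hkn h3)]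
        have hnd1 : (rest.erase j).Nodup := hnd'.2.erase j
        have hmem : ∀ p, p ∈ (rest.erase j).erase k ↔ p ≠ k ∧ p ≠ j ∧ p ∈ rest := by
          intro p
          rw [hnd1.mem_erase_iff, hnd'.2.mem_erase_iff]
        apply ih _ _ (by simpa using hl) hE3 _ (hnd1.erase k)
        · have := (List.erase_sublist (a := k) (l := rest.erase j)).length_le
          have := (List.erase_sublist (a := j) (l := rest)).length_le
          omega
        · intro p hp
          rw [hmem] at hp ⊢
          have hpi : p ≠ i := fun e => hnd'.1 (e ▸ hp.2.2)
          have hpp := (hU p).1 (by simp [hp.2.2])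
          have e := (hg p hpp.1 hpp.2.1).2.2
          have hgp := hcl p (by simp [hp.2.2])
          refine ⟨?_, ?_, ?_⟩
          · intro h; rw [h, h3, hjd] at e; exact hp.2.1 e.symm
          · intro h; rw [h, hkd, h3] at e; exact hpi e.symm
          · rcases List.mem_cons.1 hgp with h | h
            · rw [h, hjd, hkd] at e; exact absurd e.symm hp.1
            · exact h
        · intro p
          rw [hmem, getD_set _ _ _ _ (by simp; omega), getD_set _ _ _ _ (by simp; omega),
            getD_set _ _ _ _ (by omega)]
          have h := hU p
          rw [List.mem_cons] at h
          by_cases hpk : p = k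
          · simp [hpk]; omega
          by_cases hpj : p = j
          · subst hpj; simp [hpk]; omega
          by_cases hpi : p = i
          · subst hpi; simp [hpk, hpj, hnd'.1]; omega
          simpa [hpk, hpj, hpi] using h

theorem chkR132_true (g : ℕ → ℕ)
    (hav : ∀ i j k, i < j → j < k → g i ≠ 0 → g j ≠ 0 → g k ≠ 0 → ¬ (g i < g k ∧ g k < g j))
    (hinj : ∀ i j, g i ≠ 0 → g i = g j → i = j) (p v mn : ℕ) (hv : g p = v) (hv0 : v ≠ 0)
    (hmn : v ≤ mn ∨ ∃ a, a < p ∧ g a = mn ∧ mn ≠ 0) (E : PSt) :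
    ∀ (s m : ℕ), p < s → (∀ q, E.getD q 0 ≠ 0 → E.getD q 0 = g (s + q)) →
      (m = v ∨ ∃ b, p < b ∧ b < s ∧ g b = m ∧ v < m) → chkR132 v mn E m = true := by
  induction E with
  | nil => intro s m _ _ _; rfl
  | cons w t ih =>
    intro s m hs hE hm
    have h : chkR132 v mn (w :: t) m =
      sel(Nat.ble w v, sel(Nat.ble w mn, chkR132 v mn t m, false),
        sel(Nat.ble m w, chkR132 v mn t w, false)) := rfl
    rw [h, sel_eq, sel_eq, sel_eq]
    have hE' : ∀ q, t.getD q 0 ≠ 0 → t.getD q 0 = g (s + 1 + q) := by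
      intro q hq
      have := hE (q + 1) (by simpa using hq)
      rw [show s + 1 + q = s + (q + 1) by omega]
      simpa using this
    have hw : w ≠ 0 → w = g s := by
      intro h0
      simpa using hE 0 (by simpa using h0)
    have hmm : m = v ∨ ∃ b, p < b ∧ b < s + 1 ∧ g b = m ∧ v < m := by
      rcases hm with h | ⟨b, h1, h2, h3⟩
      · exact Or.inl h
      · exact Or.inr ⟨b, h1, by omega, h3⟩
    simp only [Nat.ble_eq]
    split_ifs with h1 h2 h3
    · exact ih (s + 1) m (by omega) hE' hmm
    · exfalso
      have hws := hw (by omega)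
      rcases hmn with h | ⟨a, ha, hga, hmn0⟩
      · omega
      · have : w ≠ v := by
          intro e
          have := hinj s p (by omega) (by omega)
          omega
        exact hav a p s ha hs (by omega) (by omega) (by omega) ⟨by omega, by omega⟩
    · exact ih (s + 1) w (by omega) hE' (Or.inr ⟨s, hs, by omega, (hw (by omega)).symm, by omega⟩)
    · exfalso
      have hws := hw (by omega)
      rcases hm with h | ⟨b, hb1, hb2, hb3, hb4⟩
      · omega
      · exact hav p b s hb1 hb2 (by omega) (by omega) (by omega) ⟨by omega, by omega⟩

theorem chk132_true (g : ℕ → ℕ)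
    (hav : ∀ i j k, i < j → j < k → g i ≠ 0 → g j ≠ 0 → g k ≠ 0 → ¬ (g i < g k ∧ g k < g j))
    (hinj : ∀ i j, g i ≠ 0 → g i = g j → i = j) (p v : ℕ) (hv : g p = v) (hv0 : v ≠ 0)
    (hv100 : v ≤ 100) (E : PSt) :
    ∀ (s r mn : ℕ), s + r = p → (∀ q, E.getD q 0 ≠ 0 → E.getD q 0 = g (s + q)) →
      (mn = 100 ∨ ∃ a, a < s ∧ g a = mn ∧ mn ≠ 0) → chk132 v E r mn = true := by
  induction E with
  | nil => intro s r mn _ _ _; rfl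
  | cons w t ih =>
    intro s r mn hs hE hm
    have hE' : ∀ q, t.getD q 0 ≠ 0 → t.getD q 0 = g (s + 1 + q) := by
      intro q hq
      have := hE (q + 1) (by simpa using hq)
      rw [show s + 1 + q = s + (q + 1) by omega]
      simpa using this
    have hw : w ≠ 0 → w = g s := by
      intro h0
      simpa using hE 0 (by simpa using h0)
    cases r with
    | zero =>
      have hsp : s = p := by omega
      subst hsp
      have h : chk132 v (w :: t) 0 mn = chkR132 v mn t v := rfl
      rw [h]
      refine chkR132_true g hav hinj s v mn hv hv0 ?_ t (s + 1) v (by omega) hE' (Or.inl rfl)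
      rcases hm with h | h
      · left; omega
      · right; exact h
    | succ q =>
      have h : chk132 v (w :: t) (q + 1) mn = sel(Nat.ble w v,
          sel(Nat.beq w 0, chk132 v t q mn, sel(Nat.ble mn w, chk132 v t q mn, chk132 v t q w)),
          sel(Nat.ble v mn, chk132 v t q mn, false)) := rfl
      rw [h]
      simp only [sel_eq, Nat.ble_eq]
      have hmm : mn = 100 ∨ ∃ a, a < s + 1 ∧ g a = mn ∧ mn ≠ 0 := by
        rcases hm with h | ⟨b, h1, h2⟩
        · exact Or.inl h
        · exact Or.inr ⟨b, by omega, h2⟩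
      have key := ih (s + 1) q mn (by omega) hE' hmm
      split_ifs with h1 h2 h3 h4
      · exact key
      · exact key
      · have hw0 : w ≠ 0 := by
          intro e; subst e; exact h2 rfl
        exact ih (s + 1) q w (by omega) hE' (Or.inr ⟨s, by omega, (hw hw0).symm, hw0⟩)
      · exact key
      · exfalso
        have hws := hw (by omega)
        rcases hm with h | ⟨a, ha, hga, hmn0⟩
        · omega
        · exact hav a s p ha (by omega) (by omega) (by omega) (by omega) ⟨by omega, by omega⟩

/-! ### The search lists distinct states -/

theorem srchS_mem (av : PSt → ℕ → ℕ → Bool) (m : ℕ) :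
    ∀ (U : List ℕ) (E : PSt), U.Nodup → (∀ p ∈ U, p < E.length) → ∀ E' ∈ srchS av m U E,
      E'.length = E.length ∧ ∀ p, p ∉ U → E'.getD p 0 = E.getD p 0 := by
  induction m with
  | zero => intro U E _ _ E' h; simp [srchS] at h; simp [h]
  | succ m ih =>
    intro U E hnd hlt E' h
    cases U with
    | nil => simp [srchS] at h; simp [h]
    | cons i rest =>
      have hnd' := List.nodup_cons.1 hnd
      have hi : i < E.length := hlt i (by simp)
      have hr : ∀ p ∈ rest, p < E.length := fun p hp => hlt p (by simp [hp])
      rw [srchS, List.mem_append] at h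
      rcases h with h | h
      · split_ifs at h with ha
        · obtain ⟨h1, h2⟩ := ih rest _ hnd'.2 (by simpa using hr) E' h
          refine ⟨by simpa using h1, ?_⟩
          intro p hp
          simp only [List.mem_cons, not_or] at hp
          rw [h2 p hp.2, getD_set _ _ _ _ hi, if_neg hp.1]
        · simp at h
      · simp only [List.mem_flatMap] at h
        obtain ⟨j, hj, h⟩ := h
        split_ifs at h with ha
        · simp only [List.mem_flatMap] at h
          obtain ⟨k, hk, h⟩ := h
          split_ifs at h with hb hc
          · have hkr := List.mem_of_mem_erase hk
            obtain ⟨h1, h2⟩ := ih _ _ ((hnd'.2.erase j).erase k)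
              (by
                intro p hp
                simpa using hr p (List.mem_of_mem_erase (List.mem_of_mem_erase hp))) E' h
            refine ⟨by simpa using h1, ?_⟩
            intro p hp
            simp only [List.mem_cons, not_or] at hp
            rw [h2 p (fun hh => hp.2 (List.mem_of_mem_erase (List.mem_of_mem_erase hh))),
              getD_set _ _ _ _ (by simpa using hr k hkr), getD_set _ _ _ _ (by simpa using hr j hj),
              getD_set _ _ _ _ hi, if_neg (fun e : p = k => hp.2 (e ▸ hkr)),
              if_neg (fun e : p = j => hp.2 (e ▸ hj)), if_neg hp.1]
          · simp at h
          · simp at h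
        · simp at h

theorem srchS_nodup (av : PSt → ℕ → ℕ → Bool) (m : ℕ) :
    ∀ (U : List ℕ) (E : PSt), U.Nodup → (∀ p ∈ U, p < E.length) → (srchS av m U E).Nodup := by
  induction m with
  | zero => intro U E _ _; simp [srchS]
  | succ m ih =>
    intro U E hnd hlt
    cases U with
    | nil => simp [srchS]
    | cons i rest =>
      have hnd' := List.nodup_cons.1 hnd
      have hi : i < E.length := hlt i (by simp)
      have hr : ∀ p ∈ rest, p < E.length := fun p hp => hlt p (by simp [hp])
      have hnd2 : ∀ j k, ((rest.erase j).erase k).Nodup := fun j k => (hnd'.2.erase j).erase k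
      have hlt2 : ∀ j k, ∀ p ∈ (rest.erase j).erase k,
          p < (((E.set i j).set j k).set k i).length := by
        intro j k p hp
        simpa using hr p (List.mem_of_mem_erase (List.mem_of_mem_erase hp))
      have hval : ∀ j ∈ rest, ∀ k ∈ rest.erase j, ∀ E',
          E' ∈ (if av (E.set i j) j k then
            if av ((E.set i j).set j k) k i then
              srchS av m ((rest.erase j).erase k) (((E.set i j).set j k).set k i)
            else []
          else []) → E'.getD i 0 = j ∧ E'.getD j 0 = k := by
        intro j hj k hk E' h
        have hij : i ≠ j := fun e => hnd'.1 (e ▸ hj)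
        have hkr := List.mem_of_mem_erase hk
        have hik : i ≠ k := fun e => hnd'.1 (e ▸ hkr)
        have hjk : j ≠ k := fun e => ((hnd'.2.mem_erase_iff).1 hk).1 e.symm
        split_ifs at h with hb hc
        · obtain ⟨_, h2⟩ := srchS_mem av m _ _ (hnd2 j k) (hlt2 j k) E' h
          rw [h2 i (fun hh => hnd'.1 (List.mem_of_mem_erase (List.mem_of_mem_erase hh))),
            h2 j (fun hh => ((hnd'.2.mem_erase_iff).1 (List.mem_of_mem_erase hh)).1 rfl)]
          simp only [getD_set _ _ _ _ (show k < ((E.set i j).set j k).length by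
            simpa using hr k hkr), getD_set _ _ _ _ (show j < (E.set i j).length by
            simpa using hr j hj), getD_set _ _ _ _ hi]
          simp [hij, hik, hjk]
        · simp at h
        · simp at h
      rw [srchS, List.nodup_append]
      refine ⟨?_, ?_, ?_⟩
      · split_ifs
        · exact ih _ _ hnd'.2 (by simpa using hr)
        · simp
      · rw [List.nodup_flatMap]
        refine ⟨?_, ?_⟩
        · intro j hj
          split_ifs
          · rw [List.nodup_flatMap]
            refine ⟨?_, ?_⟩
            · intro k hk
              split_ifs
              · exact ih _ _ (hnd2 j k) (hlt2 j k)
              · simp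
              · simp
            · refine List.Pairwise.imp_of_mem ?_ (hnd'.2.erase j)
              intro k k' hk hk' hne E' h h'
              exact hne ((hval j hj k hk E' h).2.symm.trans (hval j hj k' hk' E' h').2)
          · simp
        · refine List.Pairwise.imp_of_mem ?_ hnd'.2
          intro j j' hj hj' hne E' h h'
          simp only at h h'
          split_ifs at h with ha
          · split_ifs at h' with ha'
            · obtain ⟨k, hk, h⟩ := List.mem_flatMap.1 h
              obtain ⟨k', hk', h'⟩ := List.mem_flatMap.1 h'
              exact hne ((hval j hj k hk E' h).1.symm.trans (hval j' hj' k' hk' E' h').1)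
            · simp at h'
          · simp at h
      · intro E' h E'' h' e
        subst e
        split_ifs at h with ha
        · obtain ⟨_, h2⟩ := srchS_mem av m _ _ hnd'.2 (by simpa using hr) E' h
          have e1 : E'.getD i 0 = i := by
            rw [h2 i hnd'.1, getD_set _ _ _ _ hi, if_pos rfl]
          obtain ⟨j, hj, h'⟩ := List.mem_flatMap.1 h'
          split_ifs at h' with ha'
          · obtain ⟨k, hk, h'⟩ := List.mem_flatMap.1 h'
            have := (hval j hj k hk E' h').1
            exact hnd'.1 (by rw [← e1, this]; exact hj)
          · simp at h'
        · simp at h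

/-! ### The final test -/

theorem chkR321_sound (v : ℕ) (E : PSt) : ∀ m, chkR321 v 0 E m = true →
    (∀ q, E.getD q 0 ≠ 0 → E.getD q 0 < v → m ≤ E.getD q 0) ∧
    (∀ q r, q < r → E.getD q 0 ≠ 0 → E.getD r 0 ≠ 0 → E.getD q 0 < v → E.getD r 0 < v →
      E.getD q 0 ≤ E.getD r 0) := by
  induction E with
  | nil => intro m _; simp
  | cons w t ih =>
    intro m h
    have h' : sel(Nat.beq w 0, chkR321 v 0 t m, sel(Nat.ble v w, chkR321 v 0 t m,
        sel(Nat.ble m w, chkR321 v 0 t w, false))) = true := h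
    simp only [sel_eq, Nat.ble_eq, Nat.beq_eq] at h'
    split_ifs at h' with h1 h2 h3
    · obtain ⟨a, b⟩ := ih m h'
      refine ⟨?_, ?_⟩
      · rintro (_ | q) <;> simp [h1] 
        simpa using a q
      · rintro (_ | q) (_ | r) <;> simp [h1]
        simpa using b q r
    · obtain ⟨a, b⟩ := ih m h'
      refine ⟨?_, ?_⟩
      · rintro (_ | q)
        · simp; omega
        · simpa using a q
      · rintro (_ | q) (_ | r)
        · simp
        · simp; omega
        · simp
        · simpa using b q r
    · obtain ⟨a, b⟩ := ih w h'
      refine ⟨?_, ?_⟩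
      · rintro (_ | q)
        · simp; omega
        · intro x y
          have := a q (by simpa using x) (by simpa using y)
          simp at *; omega
      · rintro (_ | q) (_ | r)
        · simp
        · intro _ _ x _ y
          have := a r (by simpa using x) (by simpa using y)
          simpa using this
        · simp
        · simpa using b q r

theorem full321_sound (E : PSt) : full321 E = true →
    ∀ i j k, i < j → j < k → E.getD i 0 ≠ 0 → E.getD j 0 ≠ 0 → E.getD k 0 ≠ 0 →
      ¬ (E.getD j 0 < E.getD i 0 ∧ E.getD k 0 < E.getD j 0) := by
  induction E with
  | nil => intro _; simp
  | cons v t ih =>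
    intro h
    have h' : bsel (chkR321 v 0 t 0) (full321 t) false = true := h
    rw [bsel_eq] at h'
    split_ifs at h' with h1
    obtain ⟨_, b⟩ := chkR321_sound v t 0 h1
    rintro (_ | i) (_ | j) (_ | k) hij hjk <;> try omega
    · intro _ hj hk ⟨x, y⟩
      simp only [List.getD_cons_zero, List.getD_cons_succ] at *
      have := b j k (by omega) hj hk x (by omega)
      omega
    · simpa using ih h' i j k (by omega) (by omega)

theorem allB_sound (f : ℕ → Bool) (l : List ℕ) : allB f l = true → ∀ a ∈ l, f a = true := by
  induction l with
  | nil => simp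
  | cons x t ih =>
    intro h
    have h' : bsel (f x) (allB f t) false = true := h
    rw [bsel_eq] at h'
    split_ifs at h' with h1
    intro a ha
    rcases List.mem_cons.1 ha with e | e
    · rw [e]; exact h1
    · exact ih h' a e

theorem mem_U0 (n p : ℕ) : p ∈ U0 n ↔ 1 ≤ p ∧ p ≤ n := by
  unfold U0
  rw [List.range_succ_eq_map]
  simp
  constructor
  · rintro ⟨a, h, rfl⟩; omega
  · intro h; exact ⟨p - 1, by omega, by omega⟩

theorem nodup_U0 (n : ℕ) : (U0 n).Nodup := List.nodup_range.tail

theorem good_sound (n : ℕ) (E : PSt) (h : good n (U0 n) E = true) :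
    (∀ p, 1 ≤ p → p ≤ n → 1 ≤ E.getD p 0 ∧ E.getD p 0 ≤ n ∧
      E.getD (E.getD (E.getD p 0) 0) 0 = p) ∧ full321 E = true := by
  unfold good at h
  rw [bsel_eq] at h
  split_ifs at h with h1
  refine ⟨?_, h⟩
  intro p hp hpn
  have := allB_sound _ _ h1 p ((mem_U0 n p).2 ⟨hp, hpn⟩)
  simp only [bsel_eq, lookD_eq, Nat.ble_eq] at this
  split_ifs at this with a b
  exact ⟨a, b, Nat.eq_of_beq_eq_true this⟩

/-! ### Encoding of permutations -/

def enc {n : ℕ} (π : Equiv.Perm (Fin n)) : PSt := 0 :: List.ofFn (fun i => (π i : ℕ) + 1)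

theorem enc_length {n : ℕ} (π : Equiv.Perm (Fin n)) : (enc π).length = n + 1 := by simp [enc]

theorem enc_zero {n : ℕ} (π : Equiv.Perm (Fin n)) : (enc π).getD 0 0 = 0 := by simp [enc]

theorem enc_succ {n : ℕ} (π : Equiv.Perm (Fin n)) (i : Fin n) :
    (enc π).getD (i + 1) 0 = π i + 1 := by
  simp [enc]

theorem enc_ne {n : ℕ} (π : Equiv.Perm (Fin n)) (p : ℕ) (h : (enc π).getD p 0 ≠ 0) :
    ∃ i : Fin n, p = i + 1 := by
  have h0 : p ≠ 0 := by
    rintro rfl; exact h (enc_zero π)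
  have h1 : p < n + 1 := by
    by_contra hc
    apply h
    rw [List.getD_eq_default]
    rw [enc_length]; omega
  exact ⟨⟨p - 1, by omega⟩, by simp; omega⟩

theorem enc_inj {n : ℕ} : Function.Injective (enc (n := n)) := by
  intro π σ h
  ext i
  have h1 := enc_succ π i
  rw [h, enc_succ] at h1
  omega

theorem upper (n N : ℕ) (hn : n ≤ 12)
    (h : lenLE (srchK av132 n (U0 n) (E0 n) []) N = true) :
    Nat.card {π : Equiv.Perm (Fin n) // π ^ 3 = 1 ∧ Avoids132 π} ≤ N := by
  have hl := lenLE_sound _ _ h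
  rw [srchK_eq, List.append_nil] at hl
  set L := srchS av132 n (U0 n) (E0 n) with hL
  have hmem : ∀ π : Equiv.Perm (Fin n), π ^ 3 = 1 ∧ Avoids132 π → enc π ∈ L := by
    rintro π ⟨h3, hA⟩
    have hgz : ∀ q, (E0 n).getD q 0 = 0 := by
      intro q
      simp only [E0, List.getD_eq_getElem?_getD, List.getElem?_replicate]
      split_ifs <;> rfl
    refine srchS_complete av132 n (fun p => (enc π).getD p 0) ?_ ?_ (enc π) (enc_length π)
      (fun _ => rfl) (enc_zero π) n (U0 n) (E0 n) (by simp [E0]) ?_ ?_ (nodup_U0 n)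
      (by simp [U0]) ?_
    · intro p hp hpn
      obtain ⟨i, rfl⟩ : ∃ i : Fin n, p = i + 1 := ⟨⟨p - 1, by omega⟩, by simp; omega⟩
      simp only [enc_succ]
      have e : π (π (π i)) = i := by
        have := congrArg (fun σ : Equiv.Perm (Fin n) => σ i) h3
        simpa [pow_succ] using this
      rw [e]
      have := (π i).isLt
      omega
    · intro E p v hE hp hpn hv
      obtain ⟨i, rfl⟩ : ∃ i : Fin n, p = i + 1 := ⟨⟨p - 1, by omega⟩, by simp; omega⟩
      have hv' := hv
      simp only [enc_succ] at hv'
      have := (π i).isLt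
      refine chk132_true (fun p => (enc π).getD p 0) ?_ ?_ (i + 1) v hv (by omega) (by omega)
        E 0 (i + 1) 100 (by omega) (by simpa using hE) (Or.inl rfl)
      · intro a b c hab hbc ha hb hc
        obtain ⟨a, rfl⟩ := enc_ne π a ha
        obtain ⟨b, rfl⟩ := enc_ne π b hb
        obtain ⟨c, rfl⟩ := enc_ne π c hc
        simp only [enc_succ]
        rintro ⟨x, y⟩
        exact hA ⟨a, b, c, Fin.lt_def.2 (by omega), Fin.lt_def.2 (by omega),
          Fin.lt_def.2 (by omega), Fin.lt_def.2 (by omega)⟩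
      · intro a b ha hab
        obtain ⟨b, rfl⟩ := enc_ne π b (hab ▸ ha)
        obtain ⟨a, rfl⟩ := enc_ne π a ha
        simp only [enc_succ] at hab
        have : π a = π b := Fin.ext (by omega)
        rw [π.injective this]
    · intro q hq
      exact absurd (hgz q) hq
    · intro p
      rw [mem_U0, hgz]
      simp
    · intro p hp
      rw [mem_U0] at hp ⊢
      obtain ⟨i, rfl⟩ : ∃ i : Fin n, p = i + 1 := ⟨⟨p - 1, by omega⟩, by simp; omega⟩
      simp only [enc_succ]
      have := (π i).isLt
      omega
  have hc : Nat.card {π : Equiv.Perm (Fin n) // π ^ 3 = 1 ∧ Avoids132 π} ≤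
      Nat.card {x // x ∈ L.toFinset} := by
    refine Nat.card_le_card_of_injective
      (fun π => ⟨enc π.1, List.mem_toFinset.2 (hmem π.1 π.2)⟩) ?_
    intro π σ e
    exact Subtype.ext (enc_inj (congrArg Subtype.val e))
  rw [Nat.card_eq_fintype_card (α := {x // x ∈ L.toFinset}), Fintype.card_coe] at hc
  exact hc.trans ((List.toFinset_card_le L).trans hl)

theorem lower (n N : ℕ)
    (h : cntGE (good n (U0 n)) (srchK av321 n (U0 n) (E0 n) []) N = true) :
    N ≤ Nat.card {π : Equiv.Perm (Fin n) // π ^ 3 = 1 ∧ Avoids321 π} := by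
  have hl := cntGE_sound _ _ _ h
  rw [srchK_eq, List.append_nil] at hl
  have hlt : ∀ p ∈ U0 n, p < (E0 n).length := by
    intro p hp
    rw [mem_U0] at hp
    simp [E0]; omega
  have hnd := (srchS_nodup av321 n (U0 n) (E0 n) (nodup_U0 n) hlt).filter (good n (U0 n))
  have hm := srchS_mem av321 n (U0 n) (E0 n) (nodup_U0 n) hlt
  generalize hL : (srchS av321 n (U0 n) (E0 n)).filter (good n (U0 n)) = L at hl hnd
  have hex : ∀ x : {x // x ∈ L.toFinset}, ∃ π : Equiv.Perm (Fin n),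
      (π ^ 3 = 1 ∧ Avoids321 π) ∧ enc π = x.1 := by
    rintro ⟨E, hE⟩
    rw [List.mem_toFinset, ← hL, List.mem_filter] at hE
    obtain ⟨hE, hgood⟩ := hE
    obtain ⟨hlen, hout⟩ := hm E hE
    obtain ⟨h3, hfull⟩ := good_sound n E hgood
    have hE0 : E.getD 0 0 = 0 := by
      rw [hout 0 (by rw [mem_U0]; omega)]; simp [E0]
    let f : Fin n → Fin n := fun i => ⟨E.getD (i + 1) 0 - 1, by
      have := h3 (i + 1) (by omega) (by omega)
      omega⟩
    have hf : ∀ i : Fin n, E.getD (i + 1) 0 = f i + 1 := by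
      intro i
      have := h3 (i + 1) (by omega) (by omega)
      simp only [f]
      omega
    have hf3 : ∀ i, f (f (f i)) = i := by
      intro i
      have := (h3 (i + 1) (by omega) (by omega)).2.2
      rw [hf, hf, hf] at this
      exact Fin.ext (by omega)
    let π : Equiv.Perm (Fin n) := ⟨f, fun i => f (f i), hf3, hf3⟩
    refine ⟨π, ⟨?_, ?_⟩, ?_⟩
    · ext i
      have : π (π (π i)) = i := hf3 i
      simp [pow_succ, this]
    · rintro ⟨i, j, k, hij, hjk, h1, h2⟩
      have h1' : f j < f i := h1
      have h2' : f k < f j := h2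
      rw [Fin.lt_def] at hij hjk h1' h2'
      refine full321_sound E hfull (i + 1) (j + 1) (k + 1) (by omega) (by omega) ?_ ?_ ?_ ?_ <;>
        simp only [hf] <;> omega
    · apply List.ext_getElem
      · rw [enc_length, hlen]; simp [E0]
      · intro p h1 h2
        have e1 : (enc π).getD p 0 = (enc π)[p] := by simp [h1]
        have e2 : E.getD p 0 = E[p] := by simp [h2]
        show (enc π)[p] = E[p]
        rw [← e1, ← e2]
        rw [enc_length] at h1
        rcases Nat.eq_zero_or_pos p with rfl | hp
        · rw [enc_zero, hE0]
        · obtain ⟨i, rfl⟩ : ∃ i : Fin n, p = i + 1 := ⟨⟨p - 1, by omega⟩, by simp; omega⟩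
          rw [enc_succ, hf]
          rfl
  choose F hF1 hF2 using hex
  have hc : Nat.card {x // x ∈ L.toFinset} ≤
      Nat.card {π : Equiv.Perm (Fin n) // π ^ 3 = 1 ∧ Avoids321 π} := by
    refine Nat.card_le_card_of_injective (fun x => ⟨F x, hF1 x⟩) ?_
    intro x y e
    have e' : F x = F y := congrArg Subtype.val e
    apply Subtype.ext
    rw [← hF2 x, ← hF2 y, e']
  rw [Nat.card_eq_fintype_card (α := {x // x ∈ L.toFinset}), Fintype.card_coe,
    List.toFinset_card_of_nodup hnd] at hc
  omega

/-! ### The computations -/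

theorem up1 : lenLE (srchK av132 1 (U0 1) (E0 1) []) 1 = true := by
  decide +kernel

theorem up2 : lenLE (srchK av132 2 (U0 2) (E0 2) []) 1 = true := by
  decide +kernel

theorem up3 : lenLE (srchK av132 3 (U0 3) (E0 3) []) 3 = true := by
  decide +kernel

theorem up4 : lenLE (srchK av132 4 (U0 4) (E0 4) []) 5 = true := by
  decide +kernel

theorem up5 : lenLE (srchK av132 5 (U0 5) (E0 5) []) 7 = true := by
  decide +kernel

theorem up6 : lenLE (srchK av132 6 (U0 6) (E0 6) []) 17 = true := by
  decide +kernel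

theorem up7 : lenLE (srchK av132 7 (U0 7) (E0 7) []) 31 = true := by
  decide +kernel

theorem up8 : lenLE (srchK av132 8 (U0 8) (E0 8) []) 49 = true := by
  decide +kernel

theorem up9 : lenLE (srchK av132 9 (U0 9) (E0 9) []) 107 = true := by
  decide +kernel

theorem up10 : lenLE (srchK av132 10 (U0 10) (E0 10) []) 201 = true := by
  decide +kernel

theorem up11 : lenLE (srchK av132 11 (U0 11) (E0 11) []) 339 = true := by
  decide +kernel

theorem up12 : lenLE (srchK av132 12 (U0 12) (E0 12) []) 699 = true := by
  decide +kernel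

theorem low1 : cntGE (good 1 (U0 1)) (srchK av321 1 (U0 1) (E0 1) []) 1 = true := by
  decide +kernel

theorem low2 : cntGE (good 2 (U0 2)) (srchK av321 2 (U0 2) (E0 2) []) 1 = true := by
  decide +kernel

theorem low3 : cntGE (good 3 (U0 3)) (srchK av321 3 (U0 3) (E0 3) []) 3 = true := by
  decide +kernel

theorem low4 : cntGE (good 4 (U0 4)) (srchK av321 4 (U0 4) (E0 4) []) 5 = true := by
  decide +kernel

theorem low5 : cntGE (good 5 (U0 5)) (srchK av321 5 (U0 5) (E0 5) []) 7 = true := by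
  decide +kernel

theorem low6 : cntGE (good 6 (U0 6)) (srchK av321 6 (U0 6) (E0 6) []) 17 = true := by
  decide +kernel

theorem low7 : cntGE (good 7 (U0 7)) (srchK av321 7 (U0 7) (E0 7) []) 31 = true := by
  decide +kernel

theorem low8 : cntGE (good 8 (U0 8)) (srchK av321 8 (U0 8) (E0 8) []) 49 = true := by
  decide +kernel

theorem low9 : cntGE (good 9 (U0 9)) (srchK av321 9 (U0 9) (E0 9) []) 107 = true := by
  decide +kernel

theorem low10 : cntGE (good 10 (U0 10)) (srchK av321 10 (U0 10) (E0 10) []) 201 = true := by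
  decide +kernel

theorem low11 : cntGE (good 11 (U0 11)) (srchK av321 11 (U0 11) (E0 11) []) 339 = true := by
  decide +kernel

theorem low12 : cntGE (good 12 (U0 12)) (srchK av321 12 (U0 12) (E0 12) []) 699 = true := by
  decide +kernel

theorem order3_132_le_321 (n : ℕ) (h1 : 1 ≤ n) (h2 : n ≤ 12) :
    Nat.card {π : Equiv.Perm (Fin n) // π ^ 3 = 1 ∧ Avoids132 π} ≤
    Nat.card {π : Equiv.Perm (Fin n) // π ^ 3 = 1 ∧ Avoids321 π} := by
  interval_cases n
  · exact (upper 1 1 (by norm_num) up1).trans (lower 1 1 low1)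
  · exact (upper 2 1 (by norm_num) up2).trans (lower 2 1 low2)
  · exact (upper 3 3 (by norm_num) up3).trans (lower 3 3 low3)
  · exact (upper 4 5 (by norm_num) up4).trans (lower 4 5 low4)
  · exact (upper 5 7 (by norm_num) up5).trans (lower 5 7 low5)
  · exact (upper 6 17 (by norm_num) up6).trans (lower 6 17 low6)
  · exact (upper 7 31 (by norm_num) up7).trans (lower 7 31 low7)
  · exact (upper 8 49 (by norm_num) up8).trans (lower 8 49 low8)
  · exact (upper 9 107 (by norm_num) up9).trans (lower 9 107 low9)
  · exact (upper 10 201 (by norm_num) up10).trans (lower 10 201 low10)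
  · exact (upper 11 339 (by norm_num) up11).trans (lower 11 339 low11)
  · exact (upper 12 699 (by norm_num) up12).trans (lower 12 699 low12)
end
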